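/- Let μ = μ_P be the conformal measure on the prime Cantor set Λ_P and δ = δ_P its conformal dimension, and let θ = 21/40. If s > θδ/(2δ-1) and ψ(r) = r^δ · log^{-s}(1/r), then P^ψ(μ) = 0. -/

import Mathlib

open MeasureTheory Metric Filter Set
open scoped ENNReal Topology NNReal

noncomputable section

/-- The Gauss map `φ_a(x) = 1/(a+x)`. -/
def gaussMap (a : ℕ) (x : ℝ) : ℝ := 1 / (a + x)

/-- `φ_ω = φ_{ω₁} ∘ ⋯ ∘ φ_{ω_n}` for a finite word `ω`. -/
def wordMap : List ℕ → ℝ → ℝ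
  | [] => fun x => x
  | a :: ω => fun x => gaussMap a (wordMap ω x)

/-- `‖φ_ω'‖ = sup_{x ∈ [0,1]} |φ_ω'(x)|`. -/
def derivNorm (ω : List ℕ) : ℝ := ⨆ x : Icc (0 : ℝ) 1, |deriv (wordMap ω) (x : ℝ)|

/-- The cylinder `[ω] = φ_ω([0,1])`. -/
def cyl (ω : List ℕ) : Set ℝ := wordMap ω '' Icc 0 1

/-- The set of finite words over the alphabet `E`. -/
def words (E : Set ℕ) : Set (List ℕ) := {ω | ∀ a ∈ ω, a ∈ E}

/-- The coding map `π(ω) = [0; ω₀, ω₁, …]`. -/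
def codingMap (ω : ℕ → ℕ) : ℝ :=
  limUnder atTop fun n => wordMap (List.ofFn fun i : Fin n => ω i) 0

/-- The limit set `Λ_E`. -/
def limitSet (E : Set ℕ) : Set ℝ := codingMap '' {ω | ∀ n, ω n ∈ E}

/-- The pressure function of the Gauss IFS on the alphabet `E`. -/
def pressure (E : Set ℕ) (s : ℝ) : ℝ :=
  limUnder atTop fun n : ℕ =>
    (n : ℝ)⁻¹ * Real.log (∑' ω : Fin n → E, derivNorm (List.ofFn fun i => (ω i : ℕ)) ^ s)

/-- `μ` is the `δ`-conformal measure of the Gauss IFS on the alphabet `E`. -/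
def IsConformal (E : Set ℕ) (δ : ℝ) (μ : Measure ℝ) : Prop :=
  IsProbabilityMeasure μ ∧ μ (limitSet E)ᶜ = 0 ∧
    ∀ A : Set ℝ, A ⊆ Icc 0 1 → MeasurableSet A →
      μ A = ∑' a : E, ENNReal.ofReal (∫ x in gaussMap (a : ℕ) ⁻¹' A, |deriv (gaussMap (a : ℕ)) x| ^ δ ∂μ)

/-- The set of prime numbers. -/
def primes : Set ℕ := {p | p.Prime}

/-- `μ(J) = ∑_{a ∈ J} μ([a])` for a set of letters `J`. -/
def cylMass (μ : Measure ℝ) (J : Set ℕ) : ℝ≥0∞ := ∑' a : J, μ (cyl [(a : ℕ)])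

/-- A dimension function: continuous, increasing, positive, with `ψ(0⁺) = 0`. -/
def IsDimFun (ψ : ℝ → ℝ) : Prop :=
  ContinuousOn ψ (Ioi 0) ∧ MonotoneOn ψ (Ioi 0) ∧ (∀ r : ℝ, 0 < r → 0 < ψ r) ∧
    Tendsto ψ (𝓝[>] (0 : ℝ)) (𝓝 0)

/-- A doubling function. -/
def IsDoubling (ψ : ℝ → ℝ) : Prop :=
  ∀ C₁ : ℝ, 1 ≤ C₁ → ∃ C₂ : ℝ, 1 ≤ C₂ ∧ ∀ x y : ℝ, 0 < x → 0 < y →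
    C₁⁻¹ ≤ x / y → x / y ≤ C₁ → C₂⁻¹ ≤ ψ x / ψ y ∧ ψ x / ψ y ≤ C₂

open Classical in
/-- The `ψ`-dimensional Hausdorff measure `H^ψ`. -/
def hausdorffPsi (ψ : ℝ → ℝ) : Measure ℝ :=
  Measure.mkMetric fun d => if d = 0 then 0 else ENNReal.ofReal (ψ d.toReal)

/-- `H^ψ(μ) = inf {H^ψ(A) : A Borel, μ(ℝ∖A) = 0}`. -/
def hausdorffPsiOf (ψ : ℝ → ℝ) (μ : Measure ℝ) : ℝ≥0∞ :=
  ⨅ (A : Set ℝ) (_ : MeasurableSet A) (_ : μ Aᶜ = 0), hausdorffPsi ψ A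

/-- The `ψ`-dimensional packing pre-measure `P̃^ψ`. -/
def packingPre (ψ : ℝ → ℝ) (A : Set ℝ) : ℝ≥0∞ :=
  ⨅ (ε : ℝ) (_ : 0 < ε),
    ⨆ (D : Set (ℝ × ℝ)) (_ : D.Countable)
      (_ : ∀ p ∈ D, p.1 ∈ A ∧ 0 < p.2 ∧ 2 * p.2 ≤ ε)
      (_ : D.PairwiseDisjoint fun p => closedBall p.1 p.2),
      ∑' p : D, ENNReal.ofReal (ψ (2 * (p : ℝ × ℝ).2))

/-- The `ψ`-dimensional packing measure `P^ψ`. -/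
def packingPsi (ψ : ℝ → ℝ) (A : Set ℝ) : ℝ≥0∞ :=
  ⨅ (S : ℕ → Set ℝ) (_ : A ⊆ ⋃ i, S i), ∑' i, packingPre ψ (S i)

/-- `P^ψ(μ) = inf {P^ψ(A) : A Borel, μ(ℝ∖A) = 0}`. -/
def packingPsiOf (ψ : ℝ → ℝ) (μ : Measure ℝ) : ℝ≥0∞ :=
  ⨅ (A : Set ℝ) (_ : MeasurableSet A) (_ : μ Aᶜ = 0), packingPsi ψ A

/-- Assumption C with constant `λ`: `μ({a : λ⁻¹r < ‖φ_a'‖ ≤ r}) ≍ μ({a : ‖φ_a'‖ ≤ r})`. -/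
def AssumptionC (E : Set ℕ) (μ : Measure ℝ) (lam : ℝ) : Prop :=
  ∃ c C : ℝ≥0∞, 0 < c ∧ C ≠ ⊤ ∧ ∀ r : ℝ, 0 < r → r ≤ 1 →
    c * cylMass μ {a ∈ E | derivNorm [a] ≤ r} ≤
        cylMass μ {a ∈ E | lam⁻¹ * r < derivNorm [a] ∧ derivNorm [a] ≤ r} ∧
      cylMass μ {a ∈ E | lam⁻¹ * r < derivNorm [a] ∧ derivNorm [a] ≤ r} ≤
        C * cylMass μ {a ∈ E | derivNorm [a] ≤ r}

/-- `f` is regularly varying with exponent `s`. -/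
def RegVarying (f : ℝ → ℝ) (s : ℝ) : Prop :=
  ∀ a : ℝ, 1 < a → Tendsto (fun x => f (a * x) / f x) atTop (𝓝 (a ^ s))

/-- Assumption 1: `#(E ∩ [N,2N]) ≍ f(N)`. -/
def Assumption1 (E : Set ℕ) (f : ℝ → ℝ) : Prop :=
  ∃ c C : ℝ, 0 < c ∧ 0 < C ∧ ∀ N : ℕ, 1 ≤ N →
    c * f N ≤ ((E ∩ Icc N (2 * N)).ncard : ℝ) ∧ ((E ∩ Icc N (2 * N)).ncard : ℝ) ≤ C * f N

/-- Assumption 3: the Lyapunov exponent `-∑_{a∈E} μ(a) log ‖φ_a'‖` is finite. -/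
def Assumption3 (E : Set ℕ) (μ : Measure ℝ) : Prop :=
  Summable fun a : E => (μ (cyl [(a : ℕ)])).toReal * Real.log (derivNorm [(a : ℕ)])

/-- `W_k = {ω : λ^{-(k+1)} < ‖φ_ω'‖ ≤ λ^{-k}}`. -/
def W (lam : ℝ) (k : ℕ) : Set (List ℕ) :=
  {ω | lam ^ (-(k : ℝ) - 1) < derivNorm ω ∧ derivNorm ω ≤ lam ^ (-(k : ℝ))}

/-- `A_k = ⋃ {[ωa] : ω ∈ W_k ∩ E^*, a ∈ J}`. -/
def cylUnion (E : Set ℕ) (lam : ℝ) (k : ℕ) (J : Set ℕ) : Set ℝ :=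
  ⋃ ω ∈ W lam k ∩ words E, ⋃ a ∈ J, cyl (ω ++ [a])

/-- `S_J`: sequences in `E^ℕ` with infinitely many `(n,k)` such that `ω|n ∈ W_k`, `ω_{n+1} ∈ J_k`. -/
def Sset (E : Set ℕ) (lam : ℝ) (J : ℕ → Set ℕ) : Set (ℕ → ℕ) :=
  {ω | (∀ n, ω n ∈ E) ∧
    {p : ℕ × ℕ | (List.ofFn fun i : Fin p.1 => ω i) ∈ W lam p.2 ∧ ω p.1 ∈ J p.2}.Infinite}

/-- The upper density `D̄^ψ_μ(x)`. -/
def upperDensity (ψ : ℝ → ℝ) (μ : Measure ℝ) (x : ℝ) : ℝ≥0∞ :=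
  limsup (fun r => μ (closedBall x r) / ENNReal.ofReal (ψ r)) (𝓝[>] (0 : ℝ))

/-- The lower density `D̲^ψ_μ(x)`. -/
def lowerDensity (ψ : ℝ → ℝ) (μ : Measure ℝ) (x : ℝ) : ℝ≥0∞ :=
  liminf (fun r => μ (closedBall x r) / ENNReal.ofReal (ψ r)) (𝓝[>] (0 : ℝ))

/-- `J_{k,α,1} = {a ∈ E : ∃ r ∈ [‖φ_a'‖,1], r^{-δ} μ(B([a],r)) ≥ α Ψ(λ^{-k} r)}`. -/
def JsetH (E : Set ℕ) (δ : ℝ) (μ : Measure ℝ) (Ψ : ℝ → ℝ) (lam : ℝ) (k : ℕ) (α : ℝ) : Set ℕ :=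
  {a ∈ E | ∃ r : ℝ, derivNorm [a] ≤ r ∧ r ≤ 1 ∧
    ENNReal.ofReal (α * r ^ δ * Ψ (lam ^ (-(k : ℝ)) * r)) ≤ μ (cthickening r (cyl [a]))}

/-- `J_{k,α,-1} = {a ∈ E : ∃ r ∈ [‖φ_a'‖,1], r^{-δ} μ(B([a],r)) ≤ α Ψ(λ^{-k} r)}`. -/
def JsetP (E : Set ℕ) (δ : ℝ) (μ : Measure ℝ) (Ψ : ℝ → ℝ) (lam : ℝ) (k : ℕ) (α : ℝ) : Set ℕ :=
  {a ∈ E | ∃ r : ℝ, derivNorm [a] ≤ r ∧ r ≤ 1 ∧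
    μ (cthickening r (cyl [a])) ≤ ENNReal.ofReal (α * r ^ δ * Ψ (lam ^ (-(k : ℝ)) * r))}

/-- `S_{α,1}`. -/
def SsetH (E : Set ℕ) (δ : ℝ) (μ : Measure ℝ) (Ψ : ℝ → ℝ) (lam : ℝ) (α : ℝ) : Set (ℕ → ℕ) :=
  {ω | {p : ℕ × ℕ | (List.ofFn fun i : Fin p.1 => ω i) ∈ W lam p.2 ∧
    ω p.1 ∈ JsetH E δ μ Ψ lam p.2 α}.Infinite}

/-- `S_{α,-1}`. -/
def SsetP (E : Set ℕ) (δ : ℝ) (μ : Measure ℝ) (Ψ : ℝ → ℝ) (lam : ℝ) (α : ℝ) : Set (ℕ → ℕ) :=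
  {ω | {p : ℕ × ℕ | (List.ofFn fun i : Fin p.1 => ω i) ∈ W lam p.2 ∧
    ω p.1 ∈ JsetP E δ μ Ψ lam p.2 α}.Infinite}

/-- `M(x,pre,r) = ∑_{a ∈ E, [pre·a] ⊆ B(x,r)} μ([pre·a])`. -/
def Mform (E : Set ℕ) (μ : Measure ℝ) (x : ℝ) (pre : List ℕ) (r : ℝ) : ℝ≥0∞ :=
  ∑' a : {a : ℕ // a ∈ E ∧ cyl (pre ++ [a]) ⊆ closedBall x r}, μ (cyl (pre ++ [(a : ℕ)]))

/-- The density `|φ_a'|^δ` of the Gauss branch `φ_a`. -/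
def gaussWeight (δ : ℝ) (a : ℕ) (x : ℝ) : ℝ≥0∞ := ENNReal.ofReal (((a + x) ^ 2)⁻¹ ^ δ)

lemma two_le_of_mem_primes (a : primes) : (2 : ℝ) ≤ (a : ℕ) := by
  have h : Nat.Prime (a : ℕ) := a.2
  exact_mod_cast h.two_le

lemma abs_deriv_gaussMap (a : ℕ) (x : ℝ) : |deriv (gaussMap a) x| = ((a + x) ^ 2)⁻¹ := by
  have h : gaussMap a = fun x : ℝ => (fun y : ℝ => y⁻¹) (a + x) := by
    ext x; simp [gaussMap]
  rw [h, deriv_comp_const_add (f := fun y : ℝ => y⁻¹), deriv_inv, abs_neg, abs_of_nonneg (by positivity)]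

lemma measurable_gaussMap (a : ℕ) : Measurable (gaussMap a) := by
  unfold gaussMap; fun_prop

lemma measurable_gaussWeight (δ : ℝ) (a : ℕ) : Measurable (gaussWeight δ a) := by
  unfold gaussWeight; fun_prop

lemma gaussMap_mem_Ioo {a : ℕ} (ha : (2 : ℝ) ≤ a) {x : ℝ} (hx : x ∈ Icc (0 : ℝ) 1) :
    gaussMap a x ∈ Ioo (0 : ℝ) 1 := by
  have h : 1 < (a : ℝ) + x := by linarith [hx.1]
  refine ⟨by unfold gaussMap; positivity, ?_⟩
  unfold gaussMap
  rw [div_lt_one (by positivity)]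
  exact h

lemma abs_gaussMap_sub {a : ℕ} (ha : (2 : ℝ) ≤ a) {x y : ℝ} (hx : 0 ≤ x) (hy : 0 ≤ y) :
    |gaussMap a x - gaussMap a y| = |x - y| / ((a + x) * (a + y)) := by
  have h1 : 0 < (a : ℝ) + x := by linarith
  have h2 : 0 < (a : ℝ) + y := by linarith
  have : gaussMap a x - gaussMap a y = -((x - y) / ((a + x) * (a + y))) := by
    unfold gaussMap; field_simp; ring
  rw [this, abs_neg, abs_div, abs_of_pos (mul_pos h1 h2)]

lemma wordMap_mem_Icc (l : List ℕ) (hl : ∀ a ∈ l, (2 : ℝ) ≤ a) {x : ℝ} (hx : x ∈ Icc (0 : ℝ) 1) :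
    wordMap l x ∈ Icc (0 : ℝ) 1 := by
  induction l with
  | nil => exact hx
  | cons a l ih =>
    exact Ioo_subset_Icc_self (gaussMap_mem_Ioo (hl a (by simp)) (ih fun b hb => hl b (by simp [hb])))

lemma abs_wordMap_sub_le (l : List ℕ) (hl : ∀ a ∈ l, (2 : ℝ) ≤ a) {x y : ℝ}
    (hx : x ∈ Icc (0 : ℝ) 1) (hy : y ∈ Icc (0 : ℝ) 1) :
    |wordMap l x - wordMap l y| ≤ |x - y| * (1 / 4) ^ l.length := by
  induction l with
  | nil => simp [wordMap]
  | cons a l ih =>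
    have hl' : ∀ b ∈ l, (2 : ℝ) ≤ b := fun b hb => hl b (by simp [hb])
    have ha : (2 : ℝ) ≤ a := hl a (by simp)
    have h1 := wordMap_mem_Icc l hl' hx
    have h2 := wordMap_mem_Icc l hl' hy
    change |gaussMap a _ - gaussMap a _| ≤ _
    rw [abs_gaussMap_sub ha h1.1 h2.1, List.length_cons, pow_succ, ← mul_assoc]
    rw [div_eq_mul_inv]
    refine mul_le_mul (ih hl') ?_ (inv_nonneg.2 ?_) (by positivity)
    · rw [one_div]
      refine inv_anti₀ (by norm_num) ?_
      nlinarith [h1.1, h2.1]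
    · nlinarith [h1.1, h2.1]

lemma codingMap_mem_Icc {ω : ℕ → ℕ} (hω : ∀ n, (2 : ℝ) ≤ ω n) : codingMap ω ∈ Icc (0 : ℝ) 1 := by
  have hw : ∀ n : ℕ, ∀ a ∈ List.ofFn (fun i : Fin n => ω i), (2 : ℝ) ≤ a := by
    intro n a ha
    obtain ⟨i, rfl⟩ := (List.mem_ofFn' _ _).1 ha
    exact hω _
  have happ : ∀ (l : List ℕ) (a : ℕ) (x : ℝ), wordMap (l ++ [a]) x = wordMap l (gaussMap a x) := by
    intro l a x
    induction l with
    | nil => rfl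
    | cons b l ih => simp only [List.cons_append, wordMap, ih]
  have hc : CauchySeq fun n : ℕ => wordMap (List.ofFn fun i : Fin n => ω i) 0 := by
    refine cauchySeq_of_le_geometric (1 / 4) 1 (by norm_num) fun n => ?_
    have h0 := gaussMap_mem_Ioo (hω n) (x := 0) (by simp)
    rw [List.ofFn_succ_last, Real.dist_eq]
    simp only [Fin.val_last, Fin.val_castSucc, happ]
    have := abs_wordMap_sub_le _ (hw n) (x := 0) (y := gaussMap (ω n) 0) (by simp)
      (Ioo_subset_Icc_self h0)
    rw [List.length_ofFn] at this
    refine this.trans ?_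
    gcongr
    rw [abs_le]; constructor <;> linarith [h0.1, h0.2]
  obtain ⟨l, hl⟩ := cauchySeq_tendsto_of_complete hc
  rw [codingMap, hl.limUnder_eq]
  exact isClosed_Icc.mem_of_tendsto hl
    (Eventually.of_forall fun n => wordMap_mem_Icc _ (hw n) (by simp))

section Conformal

variable {δ : ℝ} {μ : Measure ℝ}

lemma IsConformal.ae_mem_Icc (hμ : IsConformal primes δ μ) : ∀ᵐ x ∂μ, x ∈ Icc (0 : ℝ) 1 := by
  refine measure_mono_null ?_ hμ.2.1
  refine compl_subset_compl.2 ?_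
  rintro _ ⟨ω, hω, rfl⟩
  exact codingMap_mem_Icc fun n => two_le_of_mem_primes ⟨ω n, hω n⟩

lemma IsConformal.eq_sum (hδ : 0 < δ) (hμ : IsConformal primes δ μ) :
    μ = Measure.sum fun a : primes => (μ.withDensity (gaussWeight δ a)).map (gaussMap a) := by
  have : IsProbabilityMeasure μ := hμ.1
  have hI := hμ.ae_mem_Icc
  have inter : ∀ A : Set ℝ, μ A = μ (A ∩ Icc 0 1) := fun A =>
    measure_congr (by
      filter_upwards [hI] with x hx
      exact propext ⟨fun h => ⟨h, hx⟩, fun h => h.1⟩)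
  ext A hA
  rw [inter A, hμ.2.2 _ inter_subset_right (hA.inter measurableSet_Icc), Measure.sum_apply _ hA]
  congr 1
  ext a
  have ha := two_le_of_mem_primes a
  have hpre : gaussMap a ⁻¹' (A ∩ Icc 0 1) =ᵐ[μ] gaussMap a ⁻¹' A := by
    filter_upwards [hI] with x hx
    exact propext ⟨fun h => h.1, fun h => ⟨h, Ioo_subset_Icc_self (gaussMap_mem_Ioo ha hx)⟩⟩
  rw [Measure.map_apply (measurable_gaussMap a) hA,
    withDensity_apply _ (measurable_gaussMap a hA), setIntegral_congr_set hpre]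
  simp only [abs_deriv_gaussMap]
  rw [ofReal_integral_eq_lintegral_ofReal]
  · rfl
  · refine (Integrable.of_bound (C := 1)
      (Measurable.aestronglyMeasurable (by fun_prop)) ?_).integrableOn
    filter_upwards [hI] with x hx
    rw [Real.norm_eq_abs, abs_of_nonneg (by positivity)]
    refine Real.rpow_le_one (by positivity) (inv_le_one_of_one_le₀ ?_) hδ.le
    nlinarith [hx.1]
  · exact Eventually.of_forall fun x => by positivity

lemma IsConformal.lintegral_eq (hδ : 0 < δ) (hμ : IsConformal primes δ μ) {f : ℝ → ℝ≥0∞}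
    (hf : Measurable f) :
    ∫⁻ x, f x ∂μ = ∑' a : primes, ∫⁻ x, f (gaussMap a x) * gaussWeight δ a x ∂μ := by
  conv_lhs => rw [hμ.eq_sum hδ]
  rw [lintegral_sum_measure]
  congr 1
  ext a
  rw [lintegral_map hf (measurable_gaussMap a),
    lintegral_withDensity_eq_lintegral_mul _ (measurable_gaussWeight δ a)
      (g := fun x => f (gaussMap a x)) (hf.comp (measurable_gaussMap a))]
  simp [mul_comm]

lemma IsConformal.ae_of_forall_gaussMap (hδ : 0 < δ) (hμ : IsConformal primes δ μ) {S : Set ℝ}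
    (hS : MeasurableSet S) (h : ∀ a : primes, ∀ᵐ x ∂μ, gaussMap a x ∈ S) : ∀ᵐ x ∂μ, x ∈ S := by
  have h0 := hμ.lintegral_eq hδ (f := Sᶜ.indicator 1) (measurable_one.indicator hS.compl)
  rw [lintegral_indicator_one hS.compl] at h0
  refine h0.trans ?_
  refine ENNReal.tsum_eq_zero.2 fun a => ?_
  refine lintegral_eq_zero_of_ae_eq_zero ?_
  filter_upwards [h a] with x hx
  simp [hx]

lemma IsConformal.ae_mem_Ioo (hδ : 0 < δ) (hμ : IsConformal primes δ μ) :
    ∀ᵐ x ∂μ, x ∈ Ioo (0 : ℝ) 1 :=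
  hμ.ae_of_forall_gaussMap hδ measurableSet_Ioo fun a => by
    filter_upwards [hμ.ae_mem_Icc] with x hx
    exact gaussMap_mem_Ioo (two_le_of_mem_primes a) hx

lemma floor_inv_gaussMap (a : ℕ) {x : ℝ} (hx : x ∈ Ioo (0 : ℝ) 1) : ⌊(gaussMap a x)⁻¹⌋₊ = a := by
  rw [gaussMap, one_div, inv_inv, add_comm, Nat.floor_add_natCast hx.1.le,
    Nat.floor_eq_zero.2 hx.2, zero_add]

lemma fract_inv_gaussMap (a : ℕ) {x : ℝ} (hx : x ∈ Ioo (0 : ℝ) 1) :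
    Int.fract (gaussMap a x)⁻¹ = x := by
  rw [gaussMap, one_div, inv_inv, Int.fract_natCast_add, Int.fract_eq_self.2 ⟨hx.1.le, hx.2⟩]

lemma IsConformal.ae_prime_floor (hδ : 0 < δ) (hμ : IsConformal primes δ μ) :
    ∀ᵐ x ∂μ, (⌊x⁻¹⌋₊).Prime := by
  refine hμ.ae_of_forall_gaussMap hδ (S := {x | (⌊x⁻¹⌋₊).Prime})
    ((Nat.measurable_floor.comp measurable_inv) (MeasurableSet.of_discrete (s := primes)))
    fun a => ?_
  filter_upwards [hμ.ae_mem_Ioo hδ] with x hx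
  rw [floor_inv_gaussMap _ hx]
  exact a.2

/-- The Gauss transformation. -/
def gaussShift (x : ℝ) : ℝ := Int.fract x⁻¹

lemma measurable_gaussShift : Measurable gaussShift := measurable_fract.comp measurable_inv

/-- The transfer operator of the prime Gauss system. -/
def transfer (δ : ℝ) (h : ℝ → ℝ≥0∞) (x : ℝ) : ℝ≥0∞ :=
  ∑' a : primes, h (gaussMap a x) * gaussWeight δ a x

lemma measurable_transfer {h : ℝ → ℝ≥0∞} (hh : Measurable h) : Measurable (transfer δ h) :=
  Measurable.tsum fun a : primes =>
    (hh.comp (measurable_gaussMap a)).mul (measurable_gaussWeight δ a)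

/-- Functions with the regularity of the densities `|φ_ω'|^δ`. -/
def IsTransferRegular (δ : ℝ) (h : ℝ → ℝ≥0∞) : Prop :=
  ∀ x ∈ Ioo (0 : ℝ) 1, ∀ y ∈ Ioo (0 : ℝ) 1, x ≤ y →
    h y ≤ h x ∧ h x * ENNReal.ofReal (((1 + x) ^ 2) ^ δ) ≤ h y * ENNReal.ofReal (((1 + y) ^ 2) ^ δ)

lemma isTransferRegular_one (hδ : 0 < δ) : IsTransferRegular δ fun _ => 1 := by
  intro x hx y hy hxy
  refine ⟨le_rfl, ?_⟩
  have := hx.1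
  gcongr

lemma IsTransferRegular.transfer (hδ : 0 < δ) {h : ℝ → ℝ≥0∞} (hh : IsTransferRegular δ h) :
    IsTransferRegular δ (transfer δ h) := by
  intro x hx y hy hxy
  have hx0 := hx.1
  have hy0 := hy.1
  have key : ∀ a : primes, gaussMap a y ≤ gaussMap a x := by
    intro a
    unfold gaussMap
    gcongr
  have mem : ∀ a : primes, ∀ z ∈ Ioo (0 : ℝ) 1, gaussMap a z ∈ Ioo (0 : ℝ) 1 := fun a z hz =>
    gaussMap_mem_Ioo (two_le_of_mem_primes a) (Ioo_subset_Icc_self hz)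
  constructor
  · refine ENNReal.tsum_le_tsum fun a => ?_
    have ha := two_le_of_mem_primes a
    have split : ∀ z : ℝ, 0 < z → gaussWeight δ a z =
        ENNReal.ofReal (((1 + gaussMap a z) ^ 2) ^ δ) *
          ENNReal.ofReal (((a + z + 1) ^ 2)⁻¹ ^ δ) := by
      intro z hz
      rw [← ENNReal.ofReal_mul (by positivity), ← Real.mul_rpow (by positivity) (by positivity),
        gaussWeight]
      congr 2
      unfold gaussMap
      field_simp
    rw [split x hx0, split y hy0, ← mul_assoc, ← mul_assoc]
    refine mul_le_mul' (hh _ (mem a y hy) _ (mem a x hx) (key a)).2 ?_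
    gcongr
  · unfold _root_.transfer
    rw [← ENNReal.tsum_mul_right, ← ENNReal.tsum_mul_right]
    refine ENNReal.tsum_le_tsum fun a => ?_
    have ha := two_le_of_mem_primes a
    rw [mul_assoc, mul_assoc]
    refine mul_le_mul' (hh _ (mem a y hy) _ (mem a x hx) (key a)).1 ?_
    unfold gaussWeight
    rw [← ENNReal.ofReal_mul (by positivity), ← ENNReal.ofReal_mul (by positivity),
      ← Real.mul_rpow (by positivity) (by positivity),
      ← Real.mul_rpow (by positivity) (by positivity)]
    refine ENNReal.ofReal_le_ofReal (Real.rpow_le_rpow (by positivity) ?_ hδ.le)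
    rw [← inv_pow, ← inv_pow, ← mul_pow, ← mul_pow]
    refine pow_le_pow_left₀ (by positivity) ?_ 2
    rw [inv_mul_eq_div, inv_mul_eq_div, div_le_div_iff₀ (by positivity) (by positivity)]
    nlinarith

lemma IsConformal.lintegral_iterate (hδ : 0 < δ) (hμ : IsConformal primes δ μ) (n : ℕ)
    {f h : ℝ → ℝ≥0∞} (hf : Measurable f) (hh : Measurable h) :
    ∫⁻ x, f (gaussShift^[n] x) * h x ∂μ = ∫⁻ x, f x * (transfer δ)^[n] h x ∂μ := by
  induction n generalizing h with
  | zero => rfl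
  | succ n ih =>
    have hm : Measurable fun x => f (gaussShift^[n] x) :=
      hf.comp (measurable_gaussShift.iterate n)
    rw [Function.iterate_succ_apply, ← ih (measurable_transfer hh)]
    simp only [Function.iterate_succ_apply]
    rw [hμ.lintegral_eq hδ (f := fun x => f (gaussShift^[n] (gaussShift x)) * h x)
      ((hm.comp measurable_gaussShift).mul hh)]
    simp only [transfer, ← ENNReal.tsum_mul_left]
    rw [lintegral_tsum (f := fun (a : primes) x =>
      f (gaussShift^[n] x) * (h (gaussMap a x) * gaussWeight δ a x)) fun a => (hm.mul ((hh.comp (measurable_gaussMap a)).mul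
      (measurable_gaussWeight δ a))).aemeasurable]
    congr 1
    ext a
    refine lintegral_congr_ae ?_
    filter_upwards [hμ.ae_mem_Ioo hδ] with x hx
    rw [gaussShift, fract_inv_gaussMap _ hx, mul_assoc]

/-- The Gauss transformation does not increase the conformal measure much. -/
lemma IsConformal.measure_preimage_iterate_le (hδ : 0 < δ) (hδ' : δ < 1)
    (hμ : IsConformal primes δ μ) (n : ℕ) (A : Set ℝ) :
    μ (gaussShift^[n] ⁻¹' A) ≤ 4 * μ A := by
  have : IsProbabilityMeasure μ := hμ.1
  set h := (transfer δ)^[n] fun _ => 1 with hdef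
  have hreg : IsTransferRegular δ h ∧ Measurable h := by
    rw [hdef]
    clear hdef h
    induction n with
    | zero => exact ⟨isTransferRegular_one hδ, measurable_const⟩
    | succ n ih =>
      rw [Function.iterate_succ_apply']
      exact ⟨ih.1.transfer hδ, measurable_transfer ih.2⟩
  have hint : ∫⁻ x, h x ∂μ = 1 := by
    have := hμ.lintegral_iterate hδ n (f := fun _ => 1) (h := fun _ => 1) measurable_const
      measurable_const
    simpa using this.symm
  have cmp : ∀ x ∈ Ioo (0 : ℝ) 1, ∀ y ∈ Ioo (0 : ℝ) 1, h x ≤ 4 * h y := by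
    intro x hx y hy
    rcases le_total x y with hxy | hxy
    · have h1 : 1 ≤ ENNReal.ofReal (((1 + x) ^ 2) ^ δ) :=
        ENNReal.one_le_ofReal.2 (Real.one_le_rpow (by nlinarith [hx.1]) hδ.le)
      have h4 : ENNReal.ofReal (((1 + y) ^ 2) ^ δ) ≤ 4 := by
        have : ((1 + y) ^ 2) ^ δ ≤ 4 := by
          have hb : 1 ≤ (1 + y) ^ 2 := by nlinarith [hy.1]
          calc ((1 + y) ^ 2) ^ δ ≤ ((1 + y) ^ 2) ^ (1 : ℝ) :=
                Real.rpow_le_rpow_of_exponent_le hb hδ'.le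
            _ ≤ 4 := by rw [Real.rpow_one]; nlinarith [hy.1, hy.2]
        simpa using ENNReal.ofReal_le_ofReal this
      calc h x ≤ h x * ENNReal.ofReal (((1 + x) ^ 2) ^ δ) := le_mul_of_one_le_right' h1
        _ ≤ h y * ENNReal.ofReal (((1 + y) ^ 2) ^ δ) := (hreg.1 x hx y hy hxy).2
        _ ≤ h y * 4 := by gcongr
        _ = 4 * h y := mul_comm _ _
    · calc h x ≤ h y := (hreg.1 y hy x hx hxy).1
        _ ≤ 4 * h y := le_mul_of_one_le_left' (by norm_num)
  have hJ := hμ.ae_mem_Ioo hδ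
  have bound : ∀ x ∈ Ioo (0 : ℝ) 1, h x ≤ 4 := by
    intro x hx
    calc h x = ∫⁻ _, h x ∂μ := by simp
      _ ≤ ∫⁻ y, 4 * h y ∂μ := lintegral_mono_ae (by
          filter_upwards [hJ] with y hy using cmp x hx y hy)
      _ = 4 := by rw [lintegral_const_mul _ hreg.2, hint, mul_one]
  set B := toMeasurable μ A
  have hB : MeasurableSet B := measurableSet_toMeasurable μ A
  have hBn : MeasurableSet (gaussShift^[n] ⁻¹' B) := measurable_gaussShift.iterate n hB
  calc μ (gaussShift^[n] ⁻¹' A) ≤ μ (gaussShift^[n] ⁻¹' B) :=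
        measure_mono (preimage_mono (subset_toMeasurable μ A))
    _ = ∫⁻ x, B.indicator 1 (gaussShift^[n] x) * 1 ∂μ := by
        rw [← lintegral_indicator_one hBn]
        refine lintegral_congr fun x => ?_
        rw [mul_one]; rfl
    _ = ∫⁻ x, B.indicator 1 x * h x ∂μ :=
        hμ.lintegral_iterate hδ n (measurable_one.indicator hB) measurable_const
    _ ≤ ∫⁻ x, 4 * B.indicator 1 x ∂μ := by
        refine lintegral_mono_ae ?_
        filter_upwards [hJ] with x hx
        rw [mul_comm]
        gcongr
        exact bound x hx
    _ = 4 * μ A := by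
        rw [lintegral_const_mul _ (measurable_one.indicator hB), lintegral_indicator_one hB,
          measure_toMeasurable]

lemma IsConformal.ae_forall_iterate (hδ : 0 < δ) (hδ' : δ < 1) (hμ : IsConformal primes δ μ)
    {p : ℝ → Prop} (hp : ∀ᵐ x ∂μ, p x) : ∀ᵐ x ∂μ, ∀ n, p (gaussShift^[n] x) := by
  rw [ae_all_iff]
  intro n
  have h := hμ.measure_preimage_iterate_le hδ hδ' n {x | ¬ p x}
  have hp0 : μ {x | ¬ p x} = 0 := hp
  rw [hp0, mul_zero] at h
  exact le_antisymm h (zero_le)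

/-- `g` behaves like an inverse branch of an iterate of the Gauss transformation with
denominators `q' ≤ q`. -/
structure IsGaussBranch (δ : ℝ) (μ : Measure ℝ) (g : ℝ → ℝ) (q q' : ℝ) : Prop where
  measurable : Measurable g
  one_le : 1 ≤ q
  nonneg : 0 ≤ q'
  le : q' ≤ q
  abs_sub : ∀ x ∈ Icc (0 : ℝ) 1, ∀ y ∈ Icc (0 : ℝ) 1,
    |g x - g y| = |x - y| / ((q' * x + q) * (q' * y + q))
  lintegral_le : ∀ f : ℝ → ℝ≥0∞, Measurable f →
    ∫⁻ x, f (g x) * ENNReal.ofReal (((q' * x + q) ^ 2)⁻¹ ^ δ) ∂μ ≤ ∫⁻ x, f x ∂μ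

lemma isGaussBranch_id : IsGaussBranch δ μ id 1 0 where
  measurable := measurable_id
  one_le := le_rfl
  nonneg := le_rfl
  le := zero_le_one
  abs_sub := by simp
  lintegral_le := by simp

lemma IsGaussBranch.comp (hδ : 0 < δ) (hμ : IsConformal primes δ μ) {g : ℝ → ℝ} {q q' : ℝ}
    (hg : IsGaussBranch δ μ g q q') (a : primes) :
    IsGaussBranch δ μ (g ∘ gaussMap a) ((a : ℕ) * q + q') q := by
  have ha := two_le_of_mem_primes a
  have hq := hg.one_le
  have hq' := hg.nonneg
  have hφ : ∀ x ∈ Icc (0 : ℝ) 1, gaussMap a x ∈ Icc (0 : ℝ) 1 := fun x hx =>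
    Ioo_subset_Icc_self (gaussMap_mem_Ioo ha hx)
  have hden : ∀ x ∈ Icc (0 : ℝ) 1,
      (q' * gaussMap a x + q) * (a + x) = q * x + ((a : ℕ) * q + q') := by
    intro x hx
    have : 0 < ((a : ℕ) : ℝ) + x := by linarith [hx.1]
    unfold gaussMap
    field_simp
    ring
  refine ⟨hg.measurable.comp (measurable_gaussMap a), by nlinarith, by linarith, by nlinarith,
    fun x hx y hy => ?_, fun f hf => ?_⟩
  · rw [Function.comp_apply, Function.comp_apply, hg.abs_sub _ (hφ x hx) _ (hφ y hy),
      abs_gaussMap_sub ha hx.1 hy.1, ← hden x hx, ← hden y hy, div_div]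
    congr 1
    ring
  · have hw : Measurable fun x : ℝ => ENNReal.ofReal (((q' * x + q) ^ 2)⁻¹ ^ δ) := by fun_prop
    refine le_trans ?_ (hg.lintegral_le f hf)
    rw [hμ.lintegral_eq hδ
      (f := fun x => f (g x) * ENNReal.ofReal (((q' * x + q) ^ 2)⁻¹ ^ δ)) ((hf.comp hg.measurable).mul hw)]
    refine le_trans (le_of_eq ?_) (ENNReal.le_tsum a)
    refine lintegral_congr_ae ?_
    filter_upwards [hμ.ae_mem_Icc] with x hx
    simp only [Function.comp_apply]
    rw [mul_assoc, gaussWeight, ← ENNReal.ofReal_mul (by positivity),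
      ← Real.mul_rpow (by positivity) (by positivity), ← mul_inv, ← mul_pow, hden x hx]

lemma IsGaussBranch.measure_closedBall_ge (hδ : 0 < δ) (hμ : IsConformal primes δ μ) {g : ℝ → ℝ}
    {q q' : ℝ} (hg : IsGaussBranch δ μ g q q') {y : ℝ} (hy : y ∈ Icc (0 : ℝ) 1) (r : ℝ) :
    ENNReal.ofReal ((4 * q ^ 2)⁻¹ ^ δ) * μ (closedBall y (r * q ^ 2)) ≤
      μ (closedBall (g y) r) := by
  have hq := hg.one_le
  have hq' := hg.nonneg
  have h := hg.lintegral_le ((closedBall (g y) r).indicator 1)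
    (measurable_one.indicator measurableSet_closedBall)
  rw [lintegral_indicator_one measurableSet_closedBall] at h
  refine le_trans ?_ h
  rw [← lintegral_indicator_one measurableSet_closedBall,
    ← lintegral_const_mul _ (measurable_one.indicator measurableSet_closedBall)]
  refine lintegral_mono_ae ?_
  filter_upwards [hμ.ae_mem_Icc] with x hx
  by_cases hxy : x ∈ closedBall y (r * q ^ 2)
  · have hgx : g x ∈ closedBall (g y) r := by
      rw [mem_closedBall, Real.dist_eq] at hxy ⊢
      have h1 : q ≤ q' * x + q := by nlinarith [hx.1]
      have h2 : q ≤ q' * y + q := by nlinarith [hy.1]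
      have h3 : q ^ 2 ≤ (q' * x + q) * (q' * y + q) := by nlinarith
      rw [hg.abs_sub x hx y hy, div_le_iff₀ (by nlinarith)]
      have hr : 0 ≤ r := by
        have := (abs_nonneg _).trans hxy
        by_contra hneg
        have : r * q ^ 2 < 0 := mul_neg_of_neg_of_pos (not_le.1 hneg) (by positivity)
        linarith
      exact hxy.trans (by gcongr)
    rw [indicator_of_mem hxy, indicator_of_mem hgx]
    simp only [Pi.one_apply, mul_one, one_mul]
    have h4 : q' * x + q ≤ 2 * q := by nlinarith [hx.2, hg.le]
    have h5 : 0 < q' * x + q := by nlinarith [hx.1]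
    refine ENNReal.ofReal_le_ofReal (Real.rpow_le_rpow (by positivity) ?_ hδ.le)
    refine inv_anti₀ (by positivity) ?_
    nlinarith
  · rw [indicator_of_notMem hxy, mul_zero]
    exact zero_le

lemma IsConformal.measure_cyl_ge (hδ : 0 < δ) (hμ : IsConformal primes δ μ) {a : ℕ}
    (ha : a.Prime) {S : Set ℝ} (hS : MeasurableSet S) (h : Icc (1 / ((a : ℝ) + 1)) (1 / a) ⊆ S) :
    ENNReal.ofReal ((((a : ℝ) + 1) ^ 2)⁻¹ ^ δ) ≤ μ S := by
  have : IsProbabilityMeasure μ := hμ.1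
  have ha2 : (2 : ℝ) ≤ a := by exact_mod_cast ha.two_le
  rw [← lintegral_indicator_one hS, hμ.lintegral_eq hδ (measurable_one.indicator hS)]
  refine le_trans ?_ (ENNReal.le_tsum (⟨a, ha⟩ : primes))
  calc ENNReal.ofReal ((((a : ℝ) + 1) ^ 2)⁻¹ ^ δ)
      = ∫⁻ _, ENNReal.ofReal ((((a : ℝ) + 1) ^ 2)⁻¹ ^ δ) ∂μ := by simp
    _ ≤ _ := lintegral_mono_ae ?_
  filter_upwards [hμ.ae_mem_Icc] with x hx
  have hx0 := hx.1
  have hmem : gaussMap a x ∈ S := by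
    refine h ⟨?_, ?_⟩ <;> unfold gaussMap <;> gcongr
    · exact hx.2
    · linarith
  rw [indicator_of_mem hmem, Pi.one_apply, one_mul, gaussWeight]
  refine ENNReal.ofReal_le_ofReal (Real.rpow_le_rpow (by positivity) ?_ hδ.le)
  refine inv_anti₀ (by positivity) ?_
  gcongr
  exact hx.2

/-- The points of `(0,1)` around which the conformal measure is small at scale `η`, compared with
`(η v)^δ`. -/
def sparseSet (δ : ℝ) (μ : Measure ℝ) (η v : ℝ) : Set ℝ :=
  {y | y ∈ Ioo (0 : ℝ) 1 ∧ (⌊y⁻¹⌋₊).Prime ∧ (((⌊y⁻¹⌋₊ : ℝ) + 1) ^ 2)⁻¹ < η ∧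
    μ (closedBall y (2 * η)) < ENNReal.ofReal ((η * v) ^ δ)}

lemma inv_sq_lt_of_measure_closedBall_lt (hδ : 0 < δ) (hμ : IsConformal primes δ μ) {a : ℕ}
    (ha : a.Prime) {y r t : ℝ} (ht : 0 < t)
    (h : Icc (1 / ((a : ℝ) + 1)) (1 / a) ⊆ closedBall y r)
    (hr : μ (closedBall y r) < ENNReal.ofReal (t ^ δ)) : (((a : ℝ) + 1) ^ 2)⁻¹ < t := by
  have h1 := (hμ.measure_cyl_ge hδ ha measurableSet_closedBall h).trans_lt hr
  rw [ENNReal.ofReal_lt_ofReal_iff (by positivity)] at h1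
  exact (Real.rpow_lt_rpow_iff (by positivity) ht.le hδ).1 h1

lemma mem_Icc_of_floor_inv {y : ℝ} (hy : 0 < y) (h : 0 < ⌊y⁻¹⌋₊) :
    y ∈ Icc (1 / ((⌊y⁻¹⌋₊ : ℝ) + 1)) (1 / ⌊y⁻¹⌋₊) := by
  have h1 : (⌊y⁻¹⌋₊ : ℝ) ≤ y⁻¹ := Nat.floor_le (by positivity)
  have h2 : y⁻¹ < (⌊y⁻¹⌋₊ : ℝ) + 1 := Nat.lt_floor_add_one _
  have h3 : (0 : ℝ) < ⌊y⁻¹⌋₊ := by exact_mod_cast h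
  constructor
  · rw [one_div]
    exact inv_le_of_inv_le₀ hy h2.le
  · rw [one_div]
    exact (le_inv_comm₀ h3 hy).1 h1

lemma bounds_of_mem_sparseSet (hδ : 0 < δ) (hμ : IsConformal primes δ μ) (j : ℕ) {v : ℝ}
    (hv : 0 < v) {y : ℝ} (hy : y ∈ sparseSet δ μ ((1 / 2) ^ j) v) :
    y ^ 2 < 4 * ((1 / 2) ^ j * v) ∧ (1 / 2) ^ j < 16 * v := by
  obtain ⟨hy1, hp, hη, hm⟩ := hy
  set a := ⌊y⁻¹⌋₊
  set η : ℝ := (1 / 2) ^ j with hηdef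
  have hη0 : 0 < η := by positivity
  have ha2 : (2 : ℝ) ≤ a := by exact_mod_cast hp.two_le
  obtain ⟨hya, hya'⟩ := mem_Icc_of_floor_inv hy1.1 hp.pos
  change 1 / ((a : ℝ) + 1) ≤ y at hya
  change y ≤ 1 / (a : ℝ) at hya'
  have hgap : 1 / (a : ℝ) - 1 / ((a : ℝ) + 1) ≤ 2 * (((a : ℝ) + 1) ^ 2)⁻¹ := by
    rw [div_sub_div _ _ (by positivity) (by positivity), ← div_eq_mul_inv,
      div_le_div_iff₀ (by positivity) (by positivity)]
    nlinarith
  have hA : (((a : ℝ) + 1) ^ 2)⁻¹ < η * v := by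
    refine inv_sq_lt_of_measure_closedBall_lt hδ hμ hp (by positivity) (fun z hz => ?_) hm
    rw [mem_closedBall, Real.dist_eq, abs_le]
    constructor <;> linarith [hz.1, hz.2]
  have hy2 : y ≤ 2 * ((a : ℝ) + 1)⁻¹ := by
    refine hya'.trans ?_
    rw [← div_eq_mul_inv, div_le_div_iff₀ (by positivity) (by positivity)]
    linarith
  have hinv : (((a : ℝ) + 1) ^ 2)⁻¹ = (((a : ℝ) + 1)⁻¹) ^ 2 := (inv_pow _ _).symm
  have hpos : 0 < ((a : ℝ) + 1)⁻¹ := by positivity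
  constructor
  · have : y ^ 2 ≤ (2 * ((a : ℝ) + 1)⁻¹) ^ 2 := pow_le_pow_left₀ hy1.1.le hy2 2
    nlinarith
  · rcases le_or_gt η (2 * ((a : ℝ) + 1)⁻¹) with hle | hlt
    · have : η * η < η * (16 * v) := by nlinarith
      exact lt_of_mul_lt_mul_left this hη0.le
    · obtain ⟨b, hb, hjb, hbj⟩ := Nat.exists_prime_lt_and_le_two_mul (2 ^ j) (by positivity)
      have hb1 : (2 : ℝ) ^ j < b := by exact_mod_cast hjb
      have hb2 : (b : ℝ) ≤ 2 * 2 ^ j := by exact_mod_cast hbj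
      have hη2 : η = ((2 : ℝ) ^ j)⁻¹ := by rw [hηdef, one_div, inv_pow]
      have hb0 : (0 : ℝ) < b := lt_trans (by positivity) hb1
      have hbη : 1 / (b : ℝ) ≤ η := by
        rw [hη2, one_div]
        exact inv_anti₀ (by positivity) hb1.le
      have hB : (((b : ℝ) + 1) ^ 2)⁻¹ < η * v := by
        refine inv_sq_lt_of_measure_closedBall_lt hδ hμ hb (by positivity) (fun z hz => ?_) hm
        have hz0 : 0 ≤ z := le_trans (by positivity) hz.1
        rw [mem_closedBall, Real.dist_eq, abs_le]
        constructor <;> linarith [hz.2, hy1.1]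
      have hbound : η / 4 ≤ ((b : ℝ) + 1)⁻¹ := by
        have h1 : (1 : ℝ) ≤ 2 ^ j := one_le_pow₀ one_le_two
        rw [hη2, div_eq_mul_inv, ← mul_inv]
        exact inv_anti₀ (by positivity) (by linarith)
      have hsq : (η / 4) ^ 2 ≤ (((b : ℝ) + 1) ^ 2)⁻¹ := by
        rw [← inv_pow]
        exact pow_le_pow_left₀ (by positivity) hbound 2
      have : η * η < η * (16 * v) := by nlinarith
      exact lt_of_mul_lt_mul_left this hη0.le

lemma measure_le_of_forall_mem {η Y : ℝ} (hη : 0 < η) {m : ℝ≥0∞} {S : Set ℝ}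
    (hS : ∀ y ∈ S, 0 ≤ y ∧ y ≤ Y) (hm : ∀ y ∈ S, μ (closedBall y (2 * η)) ≤ m) :
    μ S ≤ (⌊Y / η⌋₊ + 1 : ℕ) * m := by
  have hcov : S ⊆ ⋃ k ∈ Finset.range (⌊Y / η⌋₊ + 1), S ∩ Icc (k * η) ((k + 1) * η) := by
    intro y hy
    obtain ⟨hy0, hyY⟩ := hS y hy
    refine mem_iUnion₂.2 ⟨⌊y / η⌋₊, ?_, hy, ?_, ?_⟩
    · rw [Finset.mem_range, Nat.lt_succ_iff]
      exact Nat.floor_mono (by gcongr)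
    · rw [← le_div_iff₀ hη]
      exact Nat.floor_le (by positivity)
    · rw [← div_le_iff₀ hη]
      exact (Nat.lt_floor_add_one _).le
  calc μ S ≤ ∑ k ∈ Finset.range (⌊Y / η⌋₊ + 1), μ (S ∩ Icc (k * η) ((k + 1) * η)) :=
        (measure_mono hcov).trans (measure_biUnion_finset_le _ _)
    _ ≤ ∑ k ∈ Finset.range (⌊Y / η⌋₊ + 1), m := by
        refine Finset.sum_le_sum fun k _ => ?_
        rcases (S ∩ Icc (k * η) ((k + 1) * η)).eq_empty_or_nonempty with h | ⟨y, hy, hyk⟩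
        · rw [h, measure_empty]
          exact zero_le
        · refine (measure_mono fun z hz => ?_).trans (hm y hy)
          rw [mem_closedBall, Real.dist_eq, abs_le]
          constructor <;> nlinarith [hz.2.1, hz.2.2, hyk.1, hyk.2]
    _ = _ := by simp

lemma measure_sparseSet_le (hδ : 0 < δ) (hδ' : δ < 1) (hμ : IsConformal primes δ μ) (j : ℕ)
    {v κ : ℝ} (hv : 0 < v) (hκ : 0 < κ) (hκ' : κ ≤ δ - 1 / 2) :
    μ (sparseSet δ μ ((1 / 2) ^ j) v) ≤
      ENNReal.ofReal (96 * ((1 / 2) ^ j) ^ κ * v ^ (2 * δ - κ)) := by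
  have hbounds := fun y => bounds_of_mem_sparseSet hδ hμ j hv (y := y)
  set η : ℝ := (1 / 2) ^ j
  have hη : 0 < η := by positivity
  rcases (sparseSet δ μ η v).eq_empty_or_nonempty with h | ⟨y₀, hy₀⟩
  · rw [h, measure_empty]
    exact zero_le
  have hηv : η < 16 * v := (hbounds y₀ hy₀).2
  have hcover := measure_le_of_forall_mem (μ := μ) hη (Y := 2 * √(η * v))
    (m := ENNReal.ofReal ((η * v) ^ δ)) (S := sparseSet δ μ η v)
    (fun y hy => ⟨hy.1.1.le, by
      have := (hbounds y hy).1
      rw [← abs_of_pos hy.1.1, ← Real.sqrt_sq_eq_abs]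
      calc √(y ^ 2) ≤ √(2 ^ 2 * (η * v)) := Real.sqrt_le_sqrt (by linarith)
        _ = 2 * √(η * v) := by rw [Real.sqrt_mul (by positivity), Real.sqrt_sq (by norm_num)]⟩)
    (fun y hy => hy.2.2.2.le)
  refine hcover.trans ?_
  rw [← ENNReal.ofReal_natCast, ← ENNReal.ofReal_mul (by positivity)]
  refine ENNReal.ofReal_le_ofReal ?_
  have hsplit : √(η * v) / η = √(v / η) := by
    rw [Real.sqrt_mul hη.le, Real.sqrt_div hv.le]
    have : √η ≠ 0 := (Real.sqrt_pos.2 hη).ne'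
    field_simp
    rw [Real.sq_sqrt hη.le]
  have hquarter : 1 / 4 ≤ √(v / η) := by
    refine Real.le_sqrt_of_sq_le ?_
    rw [le_div_iff₀ hη]
    linarith
  have hN : ((⌊2 * √(η * v) / η⌋₊ + 1 : ℕ) : ℝ) ≤ 6 * √(v / η) := by
    push_cast
    have : (⌊2 * √(η * v) / η⌋₊ : ℝ) ≤ 2 * √(η * v) / η := Nat.floor_le (by positivity)
    rw [mul_div_assoc, hsplit] at this
    rw [mul_div_assoc, hsplit]
    linarith
  have h16 : (16 : ℝ) ^ (δ - 1 / 2 - κ) ≤ 16 := by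
    calc (16 : ℝ) ^ (δ - 1 / 2 - κ) ≤ 16 ^ (1 : ℝ) :=
          Real.rpow_le_rpow_of_exponent_le (by norm_num) (by linarith)
      _ = 16 := Real.rpow_one _
  calc ((⌊2 * √(η * v) / η⌋₊ + 1 : ℕ) : ℝ) * (η * v) ^ δ
      ≤ 6 * √(v / η) * (η * v) ^ δ := by gcongr
    _ = 6 * η ^ κ * η ^ (δ - 1 / 2 - κ) * v ^ (δ + 1 / 2) := by
        rw [Real.sqrt_eq_rpow, Real.div_rpow hv.le hη.le, Real.mul_rpow hη.le hv.le,
          Real.rpow_add hv, Real.rpow_sub hη, Real.rpow_sub hη]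
        field_simp
    _ ≤ 6 * η ^ κ * (16 * v) ^ (δ - 1 / 2 - κ) * v ^ (δ + 1 / 2) := by
        gcongr
    _ = 6 * η ^ κ * 16 ^ (δ - 1 / 2 - κ) * v ^ (2 * δ - κ) := by
        rw [Real.mul_rpow (by norm_num) hv.le, ← mul_assoc, mul_assoc _ (v ^ _) (v ^ _),
          ← Real.rpow_add hv]
        congr 2
        ring
    _ ≤ 6 * η ^ κ * 16 * v ^ (2 * δ - κ) := by gcongr
    _ = 96 * η ^ κ * v ^ (2 * δ - κ) := by ring

lemma IsConformal.ae_eventually_notMem_sparseSet (hδ : 1 / 2 < δ) (hδ' : δ < 1)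
    (hμ : IsConformal primes δ μ) {τ : ℝ} (hτ : 1 < 2 * δ * τ) :
    ∀ᵐ x ∂μ, ∀ᶠ n : ℕ in atTop, ∀ j : ℕ,
      gaussShift^[n] x ∉ sparseSet δ μ ((1 / 2) ^ j) (((n : ℝ) + 1) ^ (-τ)) := by
  have hδ0 : 0 < δ := by linarith
  have hτ0 : 0 < τ := by
    by_contra h
    nlinarith
  obtain ⟨κ, hκ, hκ', hκτ⟩ : ∃ κ, 0 < κ ∧ κ ≤ δ - 1 / 2 ∧ 1 < τ * (2 * δ - κ) := by
    have h1 : τ * (1 / (2 * τ)) = 1 / 2 := by field_simp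
    have h2 : 1 / (2 * τ) < δ := by
      rw [div_lt_iff₀ (by positivity)]
      linarith
    refine ⟨min (δ - 1 / 2) (δ - 1 / (2 * τ)), lt_min (by linarith) (by linarith),
      min_le_left _ _, ?_⟩
    have h3 := min_le_right (δ - 1 / 2) (δ - 1 / (2 * τ))
    have h4 : τ * min (δ - 1 / 2) (δ - 1 / (2 * τ)) ≤ τ * (δ - 1 / (2 * τ)) := by gcongr
    nlinarith
  have hgeom : ∑' j : ℕ, ENNReal.ofReal ((((1 : ℝ) / 2) ^ j) ^ κ) ≠ ⊤ := by
    refine Summable.tsum_ofReal_ne_top ?_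
    have : (fun j : ℕ => (((1 : ℝ) / 2) ^ j) ^ κ) = fun j : ℕ => ((1 / 2 : ℝ) ^ κ) ^ j := by
      ext j
      rw [← Real.rpow_natCast, ← Real.rpow_mul (by norm_num), mul_comm,
        Real.rpow_mul (by norm_num), Real.rpow_natCast]
    rw [this]
    exact summable_geometric_of_lt_one (by positivity)
      (Real.rpow_lt_one (by norm_num) (by norm_num) hκ)
  have hzeta : ∑' n : ℕ, ENNReal.ofReal (((n : ℝ) + 1) ^ (-(τ * (2 * δ - κ)))) ≠ ⊤ := by
    refine Summable.tsum_ofReal_ne_top ?_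
    have := (summable_nat_add_iff 1).2 (Real.summable_nat_rpow.2
      (neg_lt_neg hκτ))
    simpa using this
  set A : ℕ → Set ℝ := fun n =>
    ⋃ j : ℕ, sparseSet δ μ ((1 / 2) ^ j) (((n : ℝ) + 1) ^ (-τ))
  have hsum : ∑' n, μ (gaussShift^[n] ⁻¹' A n) ≠ ⊤ := by
    refine ne_top_of_le_ne_top (b := 4 * (ENNReal.ofReal 96 *
      ((∑' j : ℕ, ENNReal.ofReal ((((1 : ℝ) / 2) ^ j) ^ κ)) *
      ∑' n : ℕ, ENNReal.ofReal (((n : ℝ) + 1) ^ (-(τ * (2 * δ - κ))))))) (by finiteness) ?_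
    rw [← ENNReal.tsum_mul_left, ← ENNReal.tsum_mul_left, ← ENNReal.tsum_mul_left]
    refine ENNReal.tsum_le_tsum fun n => ?_
    refine (hμ.measure_preimage_iterate_le hδ0 hδ' n (A n)).trans ?_
    gcongr
    refine (measure_iUnion_le _).trans ?_
    rw [← ENNReal.tsum_mul_right, ← ENNReal.tsum_mul_left]
    refine ENNReal.tsum_le_tsum fun j => ?_
    refine (measure_sparseSet_le hδ0 hδ' hμ j (by positivity) hκ hκ').trans (le_of_eq ?_)
    rw [← Real.rpow_mul (by positivity), mul_assoc, ENNReal.ofReal_mul (by norm_num),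
      ENNReal.ofReal_mul (by positivity), neg_mul]
  filter_upwards [ae_eventually_notMem hsum] with x hx
  filter_upwards [hx] with n hn j hj
  exact hn (mem_iUnion.2 ⟨j, hj⟩)

/-- The `n`-th denominators `(q_n, q_{n-1})` of the continued fraction expansion of `x`. -/
def gaussDen (x : ℝ) : ℕ → ℝ × ℝ
  | 0 => (1, 0)
  | n + 1 => (⌊(gaussShift^[n] x)⁻¹⌋₊ * (gaussDen x n).1 + (gaussDen x n).2, (gaussDen x n).1)

lemma gaussMap_floor_gaussShift {y : ℝ} (hy : 0 < y) : gaussMap ⌊y⁻¹⌋₊ (gaussShift y) = y := by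
  have h : (⌊y⁻¹⌋₊ : ℝ) + Int.fract y⁻¹ = y⁻¹ := by
    rw [natCast_floor_eq_intCast_floor (inv_nonneg.2 hy.le), Int.floor_add_fract]
  rw [gaussMap, gaussShift, h, one_div, inv_inv]

lemma exists_isGaussBranch (hδ : 0 < δ) (hμ : IsConformal primes δ μ) {x : ℝ}
    (hx : ∀ n, gaussShift^[n] x ∈ Ioo (0 : ℝ) 1) (hp : ∀ n, (⌊(gaussShift^[n] x)⁻¹⌋₊).Prime)
    (n : ℕ) : ∃ g, IsGaussBranch δ μ g (gaussDen x n).1 (gaussDen x n).2 ∧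
      g (gaussShift^[n] x) = x := by
  induction n with
  | zero => exact ⟨id, isGaussBranch_id, rfl⟩
  | succ n ih =>
    obtain ⟨g, hg, hgx⟩ := ih
    refine ⟨_, hg.comp hδ hμ ⟨_, hp n⟩, ?_⟩
    rw [Function.iterate_succ_apply', Function.comp_apply, gaussMap_floor_gaussShift (hx n).1, hgx]

/-- Almost every point satisfies a lower bound for the mass of small balls around it. -/
lemma IsConformal.ae_measure_closedBall_ge (hδ : 1 / 2 < δ) (hδ' : δ < 1)
    (hμ : IsConformal primes δ μ) {τ : ℝ} (hτ : 1 < 2 * δ * τ) :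
    ∀ᵐ x ∂μ, ∃ r₀ > 0, ∀ r, 0 < r → r ≤ r₀ → ∃ n : ℕ, 3 ≤ n ∧ r ≤ 4 * (1 / 4) ^ n ∧
      ENNReal.ofReal ((r * ((n : ℝ) + 1) ^ (-τ) / 16) ^ δ) ≤ μ (closedBall x r) := by
  have hδ0 : 0 < δ := by linarith
  filter_upwards [hμ.ae_eventually_notMem_sparseSet hδ hδ' hτ,
    hμ.ae_forall_iterate hδ0 hδ' (hμ.ae_mem_Ioo hδ0),
    hμ.ae_forall_iterate hδ0 hδ' (hμ.ae_prime_floor hδ0)] with x hsparse hx hp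
  set q : ℕ → ℝ := fun n => (gaussDen x n).1 with hq
  have hbranch := exists_isGaussBranch hδ0 hμ hx hp
  have hone : ∀ n, 1 ≤ q n := fun n => by
    obtain ⟨g, hg, -⟩ := hbranch n
    exact hg.one_le
  have hsucc : ∀ n, 2 * q n ≤ q (n + 1) ∧ q (n + 1) ≤ ((⌊(gaussShift^[n] x)⁻¹⌋₊ : ℝ) + 1) * q n := by
    intro n
    obtain ⟨g, hg, -⟩ := hbranch n
    have h2 : (2 : ℝ) ≤ ⌊(gaussShift^[n] x)⁻¹⌋₊ := by exact_mod_cast (hp n).two_le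
    have h3 := hg.nonneg
    have h4 := hg.le
    have h5 := hg.one_le
    simp only [hq, gaussDen]
    constructor <;> nlinarith
  have hmono : Monotone q := monotone_nat_of_le_succ fun n => by linarith [(hsucc n).1, hone n]
  have hpow : ∀ n, (2 : ℝ) ^ n ≤ q n := by
    intro n
    induction n with
    | zero => simpa using hone 0
    | succ n ih => rw [pow_succ]; linarith [(hsucc n).1]
  have hpow4 : ∀ n, 4 / q n ^ 2 ≤ 4 * (1 / 4) ^ n := by
    intro n
    rw [div_eq_mul_inv, one_div, inv_pow]
    gcongr
    calc (4 : ℝ) ^ n = (2 ^ n) ^ 2 := by rw [← pow_mul, mul_comm, pow_mul]; norm_num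
      _ ≤ q n ^ 2 := by gcongr; exact hpow n
  obtain ⟨n₀, hn₀⟩ := eventually_atTop.1 (hsparse.and (eventually_ge_atTop 3))
  have hqpos : ∀ n, 0 < q n := fun n => zero_lt_one.trans_le (hone n)
  refine ⟨4 / q n₀ ^ 2, by have := hqpos n₀; positivity, fun r hr0 hr => ?_⟩
  have hex : ∃ m, 4 / q m ^ 2 < r := by
    obtain ⟨m, hm⟩ := exists_pow_lt_of_lt_one (show 0 < r / 4 by positivity)
      (show (1 / 4 : ℝ) < 1 by norm_num)
    exact ⟨m, (hpow4 m).trans_lt (by linarith)⟩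
  classical
  have hfind := Nat.find_spec hex
  have hlt : n₀ < Nat.find hex := by
    by_contra h
    have h1 : q (Nat.find hex) ≤ q n₀ := hmono (not_lt.1 h)
    have h2 : 4 / q n₀ ^ 2 ≤ 4 / q (Nat.find hex) ^ 2 := by
      have := hqpos (Nat.find hex)
      gcongr
    linarith
  obtain ⟨n, hn⟩ : ∃ n, Nat.find hex = n + 1 := Nat.exists_eq_succ_of_ne_zero (by omega)
  rw [hn] at hfind
  have hrn : r ≤ 4 / q n ^ 2 := not_lt.1 (Nat.find_min hex (m := n) (by omega))
  obtain ⟨hns, hn3⟩ := hn₀ n (by omega)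
  refine ⟨n, hn3, hrn.trans (hpow4 n), ?_⟩
  obtain ⟨g, hg, hgx⟩ := hbranch n
  change IsGaussBranch δ μ g (q n) _ at hg
  have hqn := hqpos n
  set y := gaussShift^[n] x
  set v : ℝ := ((n : ℝ) + 1) ^ (-τ)
  have hv : 0 < v := by positivity
  obtain ⟨j, hj, hj'⟩ := exists_nat_pow_near_of_lt_one (x := r * q n ^ 2 / 4) (y := (1 / 2 : ℝ))
    (by positivity) (by rw [le_div_iff₀ (by positivity)] at hrn; linarith) (by norm_num)
    (by norm_num)
  rw [pow_succ] at hj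
  set η : ℝ := (1 / 2) ^ j
  have hη : 0 < η := by positivity
  have hscale : (((⌊y⁻¹⌋₊ : ℝ) + 1) ^ 2)⁻¹ < η := by
    refine lt_of_lt_of_le ?_ hj'
    have h1 := hqpos (n + 1)
    rw [div_lt_iff₀ (by positivity)] at hfind
    have h2 : q (n + 1) ^ 2 ≤ (((⌊y⁻¹⌋₊ : ℝ) + 1) * q n) ^ 2 :=
      pow_le_pow_left₀ h1.le (hsucc n).2 2
    have h3 : r * q (n + 1) ^ 2 ≤ r * (((⌊y⁻¹⌋₊ : ℝ) + 1) * q n) ^ 2 := by gcongr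
    rw [inv_lt_iff_one_lt_mul₀ (by positivity)]
    linarith
  have hball : ENNReal.ofReal ((η * v) ^ δ) ≤ μ (closedBall y (2 * η)) := by
    by_contra h
    exact hns j ⟨hx n, hp n, hscale, not_le.1 h⟩
  have hbig := hg.measure_closedBall_ge hδ0 hμ (Ioo_subset_Icc_self (hx n)) r
  rw [hgx] at hbig
  refine le_trans ?_ hbig
  calc ENNReal.ofReal ((r * v / 16) ^ δ)
      ≤ ENNReal.ofReal ((4 * q n ^ 2)⁻¹ ^ δ * (η * v) ^ δ) := by
        rw [← Real.mul_rpow (by positivity) (by positivity)]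
        refine ENNReal.ofReal_le_ofReal (Real.rpow_le_rpow (by positivity) ?_ hδ0.le)
        rw [inv_mul_eq_div, le_div_iff₀ (by positivity)]
        have := mul_le_mul_of_nonneg_right hj' hv.le
        linarith
    _ = ENNReal.ofReal ((4 * q n ^ 2)⁻¹ ^ δ) * ENNReal.ofReal ((η * v) ^ δ) :=
        ENNReal.ofReal_mul (by positivity)
    _ ≤ _ := by
        gcongr
        refine hball.trans (measure_mono (closedBall_subset_closedBall ?_))
        linarith

lemma IsConformal.ae_measure_closedBall_ge_log (hδ : 1 / 2 < δ) (hδ' : δ < 1)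
    (hμ : IsConformal primes δ μ) {τ : ℝ} (hτ : 1 < 2 * δ * τ) :
    ∀ᵐ x ∂μ, ∃ r₀ > 0, ∀ r, 0 < r → r ≤ r₀ →
      ENNReal.ofReal ((r * (2 * Real.log (1 / (2 * r))) ^ (-τ) / 16) ^ δ) ≤
        μ (closedBall x r) := by
  have hτ0 : 0 < τ := by
    by_contra h
    nlinarith
  filter_upwards [hμ.ae_measure_closedBall_ge hδ hδ' hτ] with x ⟨r₀, hr₀, h⟩
  refine ⟨r₀, hr₀, fun r hr hrr => ?_⟩
  obtain ⟨n, hn3, hrn, hm⟩ := h r hr hrr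
  have hn3' : (3 : ℝ) ≤ n := by exact_mod_cast hn3
  have hlog : (n : ℝ) + 1 ≤ 2 * Real.log (1 / (2 * r)) := by
    have h1 : (4 : ℝ) ^ n / 8 ≤ 1 / (2 * r) := by
      rw [div_le_div_iff₀ (by norm_num) (by positivity)]
      rw [one_div, inv_pow, ← div_eq_mul_inv, le_div_iff₀ (by positivity)] at hrn
      linarith
    have h2 : Real.log ((4 : ℝ) ^ n / 8) = (2 * n - 3) * Real.log 2 := by
      rw [Real.log_div (by positivity) (by norm_num), Real.log_pow,
        show (4 : ℝ) = 2 ^ 2 by norm_num, show (8 : ℝ) = 2 ^ 3 by norm_num, Real.log_pow,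
        Real.log_pow]
      push_cast
      ring
    have h3 := Real.log_le_log (by positivity) h1
    rw [h2] at h3
    have h4 := Real.log_two_gt_d9
    nlinarith
  refine le_trans (ENNReal.ofReal_le_ofReal ?_) hm
  have h0 : (0 : ℝ) < n + 1 := by positivity
  refine Real.rpow_le_rpow ?_ ?_ (by linarith)
  · have := Real.rpow_nonneg (h0.le.trans hlog) (-τ)
    positivity
  · have := Real.rpow_le_rpow_of_nonpos h0 hlog (neg_nonpos.2 hτ0.le)
    gcongr

end Conformal

lemma packingPre_eq_zero_of_forall_le {ψ : ℝ → ℝ} {μ : Measure ℝ} [IsFiniteMeasure μ] {S : Set ℝ}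
    (h : ∀ e : ℝ≥0, 0 < e → ∃ ε > 0, ∀ x ∈ S, ∀ r, 0 < r → 2 * r ≤ ε →
      ENNReal.ofReal (ψ (2 * r)) ≤ e * μ (closedBall x r)) : packingPre ψ S = 0 := by
  have key : ∀ e : ℝ≥0, 0 < e → packingPre ψ S ≤ e * μ univ := by
    intro e he
    obtain ⟨ε, hε, hS⟩ := h e he
    refine iInf₂_le_of_le ε hε ?_
    refine iSup_le fun D => iSup_le fun hD => iSup_le fun hc => iSup_le fun hdisj => ?_
    calc ∑' p : D, ENNReal.ofReal (ψ (2 * (p : ℝ × ℝ).2))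
        ≤ ∑' p : D, e * μ (closedBall (p : ℝ × ℝ).1 (p : ℝ × ℝ).2) :=
          ENNReal.tsum_le_tsum fun p =>
            hS _ (hc p p.2).1 _ (hc p p.2).2.1 (hc p p.2).2.2
      _ = e * μ (⋃ p ∈ D, closedBall p.1 p.2) := by
          rw [ENNReal.tsum_mul_left,
            measure_biUnion hD hdisj fun p _ => measurableSet_closedBall]
      _ ≤ e * μ univ := by gcongr; exact subset_univ _
  refine le_antisymm (ENNReal.le_of_forall_pos_le_add fun e he _ => ?_) zero_le
  rw [zero_add]
  have hpos : 0 < (μ univ).toNNReal + 1 := by positivity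
  refine (key (e / ((μ univ).toNNReal + 1)) (by positivity)).trans ?_
  generalize hm : (μ univ).toNNReal = m at hpos ⊢
  rw [← ENNReal.coe_toNNReal (measure_ne_top μ univ), hm, ← ENNReal.coe_mul, ENNReal.coe_le_coe,
    div_mul_eq_mul_div, div_le_iff₀ hpos]
  gcongr
  exact le_self_add

lemma packingPsiOf_eq_zero_of_ae {ψ : ℝ → ℝ} {μ : Measure ℝ} (S : ℕ → Set ℝ)
    (hS : ∀ k, packingPre ψ (S k) = 0) (h : ∀ᵐ x ∂μ, x ∈ ⋃ k, S k) : packingPsiOf ψ μ = 0 := by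
  obtain ⟨t, ht, htm, ht0⟩ := exists_measurable_superset_of_null h
  refine le_antisymm ?_ zero_le
  refine iInf_le_of_le tᶜ (iInf_le_of_le htm.compl (iInf_le_of_le (by rwa [compl_compl]) ?_))
  refine iInf₂_le_of_le S (fun x hx => ?_) (by simp [hS])
  by_contra hxS
  exact hx (ht hxS)

lemma gauge_le {δ τ s C r : ℝ} (hr : 0 < r) (hL : 0 < Real.log (1 / (2 * r)))
    (hC : 32 ^ δ * 2 ^ (τ * δ) * Real.log (1 / (2 * r)) ^ (-(s - τ * δ)) ≤ C) :
    (2 * r) ^ δ * Real.log (1 / (2 * r)) ^ (-s) ≤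
      C * (r * (2 * Real.log (1 / (2 * r))) ^ (-τ) / 16) ^ δ := by
  set L := Real.log (1 / (2 * r))
  have hsplit : (r * (2 * L) ^ (-τ) / 16) ^ δ =
      (2 * r) ^ δ * (32 ^ δ)⁻¹ * ((2 ^ (τ * δ))⁻¹ * L ^ (-(τ * δ))) := by
    rw [show r * (2 * L) ^ (-τ) / 16 = (2 * r) * 32⁻¹ * (2 * L) ^ (-τ) by ring,
      Real.mul_rpow (by positivity) (by positivity), Real.mul_rpow (by positivity) (by positivity),
      ← Real.rpow_mul (by positivity), Real.mul_rpow (by norm_num) hL.le,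
      Real.inv_rpow (by norm_num), neg_mul, Real.rpow_neg (by norm_num : (0 : ℝ) ≤ 2)]
  have hLs : L ^ (-s) = L ^ (-(s - τ * δ)) * L ^ (-(τ * δ)) := by
    rw [← Real.rpow_add hL]
    congr 1
    ring
  calc (2 * r) ^ δ * L ^ (-s)
      = 32 ^ δ * 2 ^ (τ * δ) * L ^ (-(s - τ * δ)) * (r * (2 * L) ^ (-τ) / 16) ^ δ := by
        rw [hsplit, hLs]
        field_simp
    _ ≤ C * (r * (2 * L) ^ (-τ) / 16) ^ δ := by gcongr

lemma exists_forall_log_rpow_le {K p e : ℝ} (hp : 0 < p) (he : 0 < e) :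
    ∃ ε > 0, ∀ d, 0 < d → d ≤ ε →
      0 < Real.log (1 / d) ∧ K * Real.log (1 / d) ^ (-p) ≤ e := by
  have hlog : Tendsto (fun d : ℝ => Real.log (1 / d)) (𝓝[>] 0) atTop := by
    simp only [one_div]
    exact Real.tendsto_log_atTop.comp tendsto_inv_nhdsGT_zero
  have hlim : Tendsto (fun d : ℝ => K * Real.log (1 / d) ^ (-p)) (𝓝[>] 0) (𝓝 0) := by
    simpa using ((tendsto_rpow_neg_atTop hp).comp hlog).const_mul K
  obtain ⟨u, hu, h⟩ := mem_nhdsGT_iff_exists_Ioc_subset.1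
    ((hlog.eventually_gt_atTop 0).and (hlim.eventually_le_const he))
  exact ⟨u, hu, fun d hd hdu => h ⟨hd, hdu⟩⟩

/-- Theorem 3, part 2. With `θ = 21/40`, if `s > θδ/(2δ-1)` and
`ψ(r) = r^δ log^{-s}(1/r)`, then `P^ψ(μ_P) = 0`. -/
theorem stmt4 (δ : ℝ) (hδ₁ : 1 / 2 < δ) (hδ₂ : δ < 1) (hpress : pressure primes δ = 0)
    (μ : Measure ℝ) (hμ : IsConformal primes δ μ)
    (θ : ℝ) (hθ : θ = 21 / 40)
    (s : ℝ) (hs : θ * δ / (2 * δ - 1) < s)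
    (ψ : ℝ → ℝ) (hψ : ψ = fun r : ℝ => r ^ δ * Real.log (1 / r) ^ (-s)) :
    packingPsiOf ψ μ = 0 := by
  have : IsProbabilityMeasure μ := hμ.1
  have hs₁ : 1 / 2 < s := by
    refine lt_trans ?_ hs
    rw [hθ, lt_div_iff₀ (by linarith)]
    linarith
  obtain ⟨s', hs', hs's⟩ := exists_between hs₁
  have hδ₀ : 0 < δ := by linarith
  have hτδ : s' / δ * δ = s' := by field_simp
  refine packingPsiOf_eq_zero_of_ae (fun k : ℕ => {x | ∀ r, 0 < r → r ≤ 1 / ((k : ℝ) + 1) →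
    ENNReal.ofReal ((r * (2 * Real.log (1 / (2 * r))) ^ (-(s' / δ)) / 16) ^ δ) ≤
      μ (closedBall x r)}) (fun k => ?_) ?_
  · refine packingPre_eq_zero_of_forall_le (μ := μ) fun e he => ?_
    obtain ⟨ε, hε, h⟩ := exists_forall_log_rpow_le (K := 32 ^ δ * 2 ^ (s' / δ * δ))
      (sub_pos.2 hs's) (NNReal.coe_pos.2 he)
    refine ⟨min ε (1 / ((k : ℝ) + 1)), lt_min hε (by positivity), fun x hx r hr hrε => ?_⟩
    obtain ⟨hL, hle⟩ := h (2 * r) (by positivity) (hrε.trans (min_le_left _ _))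
    have hx' := hx r hr (by linarith [hrε.trans (min_le_right _ _)])
    calc ENNReal.ofReal (ψ (2 * r))
        ≤ ENNReal.ofReal (e * (r * (2 * Real.log (1 / (2 * r))) ^ (-(s' / δ)) / 16) ^ δ) := by
          rw [hψ]
          exact ENNReal.ofReal_le_ofReal (gauge_le hr hL (by rwa [hτδ] at hle ⊢))
      _ = e * ENNReal.ofReal ((r * (2 * Real.log (1 / (2 * r))) ^ (-(s' / δ)) / 16) ^ δ) := by
          rw [ENNReal.ofReal_mul e.coe_nonneg, ENNReal.ofReal_coe_nnreal]
      _ ≤ e * μ (closedBall x r) := by gcongr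
  · filter_upwards [hμ.ae_measure_closedBall_ge_log hδ₁ hδ₂ (τ := s' / δ) (by
      rw [mul_assoc, mul_comm δ, hτδ]; linarith)] with x ⟨r₀, hr₀, h⟩
    obtain ⟨k, hk⟩ := exists_nat_one_div_lt hr₀
    exact mem_iUnion.2 ⟨k, fun r hr hrk => h r hr (hrk.trans hk.le)⟩
end
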